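/- Let g be the symmetric bilinear form on n_{−2} ≅ R^8 (with basis X_1,…,X_8 of n_{E_II}) whose matrix has nonzero entries g_{18} = g_{81} = 1, g_{27} = g_{72} = −1, g_{36} = g_{63} = 1, g_{44} = g_{55} = −1/2. Then g is nondegenerate of signature (3,5), and for every strata-preserving derivation A of n_{E_II} there exists a scalar λ(A) ∈ R such that g(A v, w) + g(v, A w) = λ(A)·g(v,w) for all v,w ∈ n_{−2}; i.e. the degree-zero part of the Tanaka prolongation of n_{E_II} acts on n_{−2} as a subalgebra of the conformal orthogonal algebra co(3,5). -/

import Mathlib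

noncomputable section
open ComplexConjugate

/-- Points of `ℝ²⁴`, with coordinates `u^i = p (i-1)`, `x^i = p (7+i)`, `y^i = p (15+i)`
for `i = 1, …, 8`. -/
abbrev Pt : Type := Fin 24 → ℝ
/-- The bracket of the 24-dimensional 2-step nilpotent Lie algebra `n_{E_II}`, in the
basis `X_1, …, X_24` (indexed here by `0, …, 23`): for each term `ε·λ^B∧λ^D` in the E_II
structure equations one has `[X_B, X_D] = -ε·X_A`, and `X_1, …, X_8` are central. -/
def br (v w : Pt) : Pt := fun k =>
  if h : (k : ℕ) < 8 then
    (![-((v 8 * w 19 - v 19 * w 8) + (v 9 * w 18 - v 18 * w 9)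
        + (v 10 * w 17 - v 17 * w 10) + (v 11 * w 16 - v 16 * w 11)),
       -((v 8 * w 21 - v 21 * w 8) + (v 9 * w 20 - v 20 * w 9)
        + (v 12 * w 17 - v 17 * w 12) + (v 13 * w 16 - v 16 * w 13)),
       -((v 8 * w 14 - v 14 * w 8) - (v 10 * w 12 - v 12 * w 10)
        + (v 16 * w 22 - v 22 * w 16) - (v 18 * w 20 - v 20 * w 18)),
       -((v 8 * w 15 - v 15 * w 8) + (v 9 * w 14 - v 14 * w 9)
        + (v 10 * w 13 - v 13 * w 10) + (v 11 * w 12 - v 12 * w 11)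
        + (v 16 * w 23 - v 23 * w 16) + (v 17 * w 22 - v 22 * w 17)
        + (v 18 * w 21 - v 21 * w 18) + (v 19 * w 20 - v 20 * w 19)),
       -(-(v 8 * w 23 - v 23 * w 8) + (v 9 * w 22 - v 22 * w 9)
        + (v 10 * w 21 - v 21 * w 10) - (v 11 * w 20 - v 20 * w 11)
        - (v 12 * w 19 - v 19 * w 12) + (v 13 * w 18 - v 18 * w 13)
        + (v 14 * w 17 - v 17 * w 14) - (v 15 * w 16 - v 16 * w 15)),
       -((v 9 * w 15 - v 15 * w 9) - (v 11 * w 13 - v 13 * w 11)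
        + (v 17 * w 23 - v 23 * w 17) - (v 19 * w 21 - v 21 * w 19)),
       -((v 10 * w 23 - v 23 * w 10) + (v 11 * w 22 - v 22 * w 11)
        + (v 14 * w 19 - v 19 * w 14) + (v 15 * w 18 - v 18 * w 15)),
       -((v 12 * w 23 - v 23 * w 12) + (v 13 * w 22 - v 22 * w 13)
        + (v 14 * w 21 - v 21 * w 14) + (v 15 * w 20 - v 20 * w 15))] : Fin 8 → ℝ) ⟨k, h⟩
  else 0
/-- The stratum `n_{-2} = span (X_1, …, X_8)`. -/
def Nm2 : Submodule ℝ Pt where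
  carrier := {v | ∀ k : Fin 24, 8 ≤ (k : ℕ) → v k = 0}
  add_mem' := by
    intro a b ha hb
    simp only [Set.mem_setOf_eq] at ha hb ⊢
    intro k hk
    simp [Pi.add_apply, ha k hk, hb k hk]
  zero_mem' := by intro k _; rfl
  smul_mem' := by
    intro c v hv
    simp only [Set.mem_setOf_eq] at hv ⊢
    intro k hk
    simp [Pi.smul_apply, hv k hk]

/-- The stratum `n_{-1} = span (X_9, …, X_24)`. -/
def Nm1 : Submodule ℝ Pt where
  carrier := {v | ∀ k : Fin 24, (k : ℕ) < 8 → v k = 0}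
  add_mem' := by
    intro a b ha hb
    simp only [Set.mem_setOf_eq] at ha hb ⊢
    intro k hk
    simp [Pi.add_apply, ha k hk, hb k hk]
  zero_mem' := by intro k _; rfl
  smul_mem' := by
    intro c v hv
    simp only [Set.mem_setOf_eq] at hv ⊢
    intro k hk
    simp [Pi.smul_apply, hv k hk]
/-- A strata-preserving derivation: a linear endomorphism `A` with `A (n_{-1}) ⊆ n_{-1}`,
`A (n_{-2}) ⊆ n_{-2}`, and `A [v, w] = [A v, w] + [v, A w]`. -/
def IsSPDer (A : Module.End ℝ Pt) : Prop :=
  (∀ v ∈ Nm1, A v ∈ Nm1) ∧ (∀ v ∈ Nm2, A v ∈ Nm2) ∧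
    ∀ v w : Pt, A (br v w) = br (A v) w + br v (A w)

/-- The symmetric bilinear form on `n_{-2} ≅ ℝ⁸` with nonzero matrix entries
`g₁₈ = g₈₁ = 1`, `g₂₇ = g₇₂ = -1`, `g₃₆ = g₆₃ = 1`, `g₄₄ = g₅₅ = -1/2`
(in the basis `X_1, …, X_8`, indexed here by `0, …, 7`). -/
def gForm (v w : Pt) : ℝ :=
  v 0 * w 7 + v 7 * w 0 - v 1 * w 6 - v 6 * w 1 + v 2 * w 5 + v 5 * w 2
    - (1/2) * (v 3 * w 3) - (1/2) * (v 4 * w 4)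

/-- The Clifford-type operator attached to `w ∈ n_{-2}`: up to the factor `g(w, w) / 2`, it inverts
the `2`-form `g(w, [·, ·])` on `n_{-1}`. -/
def cliff (w x : Pt) : Pt :=
  ![0, 0, 0, 0, 0, 0, 0, 0,
    w 2 * x 14 + 1 / 2 * w 3 * x 15 + w 0 * x 19 + w 1 * x 21 - 1 / 2 * w 4 * x 23,
    1 / 2 * w 3 * x 14 + w 5 * x 15 + w 0 * x 18 + w 1 * x 20 + 1 / 2 * w 4 * x 22,
    -(w 2 * x 12) + 1 / 2 * w 3 * x 13 + w 0 * x 17 + 1 / 2 * w 4 * x 21 + w 6 * x 23,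
    1 / 2 * w 3 * x 12 - w 5 * x 13 + w 0 * x 16 - 1 / 2 * w 4 * x 20 + w 6 * x 22,
    w 2 * x 10 - 1 / 2 * w 3 * x 11 + w 1 * x 17 - 1 / 2 * w 4 * x 19 + w 7 * x 23,
    -(1 / 2 * w 3 * x 10) + w 5 * x 11 + w 1 * x 16 + 1 / 2 * w 4 * x 18 + w 7 * x 22,
    -(w 2 * x 8) - 1 / 2 * w 3 * x 9 + 1 / 2 * w 4 * x 17 + w 6 * x 19 + w 7 * x 21,
    -(1 / 2 * w 3 * x 8) - w 5 * x 9 - 1 / 2 * w 4 * x 16 + w 6 * x 18 + w 7 * x 20,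
    -(w 0 * x 11) - w 1 * x 13 + 1 / 2 * w 4 * x 15 + w 2 * x 22 + 1 / 2 * w 3 * x 23,
    -(w 0 * x 10) - w 1 * x 12 - 1 / 2 * w 4 * x 14 + 1 / 2 * w 3 * x 22 + w 5 * x 23,
    -(w 0 * x 9) - 1 / 2 * w 4 * x 13 - w 6 * x 15 - w 2 * x 20 + 1 / 2 * w 3 * x 21,
    -(w 0 * x 8) + 1 / 2 * w 4 * x 12 - w 6 * x 14 + 1 / 2 * w 3 * x 20 - w 5 * x 21,
    -(w 1 * x 9) + 1 / 2 * w 4 * x 11 - w 7 * x 15 + w 2 * x 18 - 1 / 2 * w 3 * x 19,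
    -(w 1 * x 8) - 1 / 2 * w 4 * x 10 - w 7 * x 14 - 1 / 2 * w 3 * x 18 + w 5 * x 19,
    -(1 / 2 * w 4 * x 9) - w 6 * x 11 - w 7 * x 13 - w 2 * x 16 - 1 / 2 * w 3 * x 17,
    1 / 2 * w 4 * x 8 - w 6 * x 10 - w 7 * x 12 - 1 / 2 * w 3 * x 16 - w 5 * x 17]

theorem br_add_left (u v w : Pt) : br (u + v) w = br u w + br v w := by
  ext k
  fin_cases k <;> simp [br] <;> ring

theorem br_smul_left (c : ℝ) (v w : Pt) : br (c • v) w = c • br v w := by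
  ext k
  fin_cases k <;> simp [br] <;> ring

theorem br_swap (v w : Pt) : br v w = -br w v := by
  ext k
  fin_cases k <;> simp [br] <;> ring

/-- The bracket, as a linear map in its first argument. -/
def brLeft (w : Pt) : Pt →ₗ[ℝ] Pt where
  toFun v := br v w
  map_add' u v := br_add_left u v w
  map_smul' c v := br_smul_left c v w

theorem br_sum_smul_left (c : Fin 24 → ℝ) (f : Fin 24 → Pt) (w : Pt) :
    br (∑ i, c i • f i) w = ∑ i, c i • br (f i) w :=
  (map_sum (brLeft w) _ _).trans (Finset.sum_congr rfl fun i _ => br_smul_left (c i) (f i) w)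

theorem br_sum_smul_right (c : Fin 24 → ℝ) (f : Fin 24 → Pt) (w : Pt) :
    br w (∑ i, c i • f i) = ∑ i, c i • br w (f i) := by
  rw [br_swap, br_sum_smul_left, ← Finset.sum_neg_distrib]
  refine Finset.sum_congr rfl fun i _ => ?_
  rw [br_swap w, smul_neg]

theorem gForm_comm (v w : Pt) : gForm v w = gForm w v := by
  simp only [gForm]
  ring

theorem gForm_add_right (u v w : Pt) : gForm u (v + w) = gForm u v + gForm u w := by
  simp only [gForm, Pi.add_apply]
  ring

theorem gForm_smul_right (c : ℝ) (v w : Pt) : gForm v (c • w) = c * gForm v w := by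
  simp only [gForm, Pi.smul_apply, smul_eq_mul]
  ring

/-- The form `g`, as a linear map in its second argument. -/
def gFormRight (v : Pt) : Pt →ₗ[ℝ] ℝ where
  toFun w := gForm v w
  map_add' := gForm_add_right v
  map_smul' c w := gForm_smul_right c v w

theorem gForm_sum_right (v : Pt) (f : Fin 24 → Pt) :
    gForm v (∑ i, f i) = ∑ i, gForm v (f i) :=
  map_sum (gFormRight v) f Finset.univ

theorem cliff_dotProduct (w x y : Pt) : cliff w x ⬝ᵥ y = -(cliff w y ⬝ᵥ x) := by
  simp only [dotProduct, Fin.sum_univ_succ, cliff, Matrix.cons_val_zero, Matrix.cons_val_succ]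
  simp
  ring

theorem cliff_single_antisymm (w : Pt) (i j : Fin 24) :
    cliff w (Pi.single i 1) j = -cliff w (Pi.single j 1) i := by
  simpa using cliff_dotProduct w (Pi.single i 1) (Pi.single j 1)

theorem gForm_br_cliff_single (w x : Pt) (i : Fin 24) :
    gForm w (br x (cliff w (Pi.single i 1))) =
      gForm w w / 2 * if 8 ≤ (i : ℕ) then x i else 0 := by
  fin_cases i <;> simp [cliff, br, gForm] <;> ring

theorem sum_br_single_cliff {w : Pt} (hw : w ∈ Nm2) :
    ∑ i, br (Pi.single i 1) (cliff w (Pi.single i 1)) = (8 : ℝ) • w := by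
  have contract (a b : Fin 24) :
      ∑ i, (Pi.single i 1 : Pt) a * cliff w (Pi.single i 1) b = cliff w (Pi.single a 1) b := by
    simp [Pi.single_apply]
  ext k
  rw [Finset.sum_apply]
  by_cases hk : (k : ℕ) < 8
  · simp only [br, hk, dif_pos]
    obtain ⟨k, _⟩ := k
    change k < 8 at hk
    interval_cases k <;>
      simp only [Fin.mk_zero, Fin.mk_one, Fin.reduceFinMk, Matrix.cons_val, Finset.sum_neg_distrib,
        Finset.sum_add_distrib, Finset.sum_sub_distrib, contract] <;>
      simp [cliff] <;> ring
  · simp [br, hk, hw k (not_lt.mp hk)]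

/-- Transposition in `n_{-1} ⊗ n_{-1}`: the bivector defined by `cliff w` is skew. -/
theorem sum_br_single_map_cliff (A : Module.End ℝ Pt) (w : Pt) :
    ∑ i, br (Pi.single i 1) (A (cliff w (Pi.single i 1))) =
      ∑ i, br (A (Pi.single i 1)) (cliff w (Pi.single i 1)) := by
  have expand (x : Pt) : x = ∑ j, x j • (Pi.single j 1 : Pt) := by
    exact pi_eq_sum_univ' x
  have left (i : Fin 24) : br (Pi.single i 1) (A (cliff w (Pi.single i 1))) =
      ∑ j, cliff w (Pi.single i 1) j • br (Pi.single i 1) (A (Pi.single j 1)) := by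
    conv_lhs => rw [expand (cliff w (Pi.single i 1)), map_sum]
    simp only [map_smul, br_sum_smul_right]
  have right (i : Fin 24) : br (A (Pi.single i 1)) (cliff w (Pi.single i 1)) =
      ∑ j, cliff w (Pi.single i 1) j • br (A (Pi.single i 1)) (Pi.single j 1) := by
    conv_lhs => rw [expand (cliff w (Pi.single i 1)), br_sum_smul_right]
  simp only [left, right]
  rw [Finset.sum_comm]
  refine Finset.sum_congr rfl fun i _ => Finset.sum_congr rfl fun j _ => ?_
  rw [cliff_single_antisymm, br_swap, smul_neg, neg_smul, neg_neg]

/-- The trace of the `n_{-1}`-block of an endomorphism. -/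
def traceNm1 (A : Module.End ℝ Pt) : ℝ :=
  ∑ i : Fin 24, if 8 ≤ (i : ℕ) then A (Pi.single i 1) i else 0

theorem IsSPDer.gForm_self_map {A : Module.End ℝ Pt} (hA : IsSPDer A) {w : Pt} (hw : w ∈ Nm2) :
    gForm w (A w) = traceNm1 A / 8 * gForm w w := by
  have h : (8 : ℝ) • A w =
      ∑ i, br (A (Pi.single i 1)) (cliff w (Pi.single i 1)) +
        ∑ i, br (A (Pi.single i 1)) (cliff w (Pi.single i 1)) := by
    rw [← map_smul, ← sum_br_single_cliff hw, map_sum]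
    simp only [hA.2.2, Finset.sum_add_distrib, sum_br_single_map_cliff]
  have h' := congrArg (gForm w) h
  rw [gForm_smul_right, gForm_add_right, gForm_sum_right] at h'
  simp only [gForm_br_cliff_single, ← Finset.mul_sum] at h'
  rw [traceNm1]
  linarith

theorem IsSPDer.gForm_map_add {A : Module.End ℝ Pt} (hA : IsSPDer A) {v w : Pt}
    (hv : v ∈ Nm2) (hw : w ∈ Nm2) :
    gForm (A v) w + gForm v (A w) = traceNm1 A / 4 * gForm v w := by
  have h := hA.gForm_self_map (Nm2.add_mem hv hw)
  have hvv := hA.gForm_self_map hv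
  have hww := hA.gForm_self_map hw
  rw [map_add, gForm_add_right, gForm_comm (v + w) (A v), gForm_comm (v + w) (A w),
    gForm_add_right, gForm_add_right, gForm_add_right, gForm_comm (v + w) v,
    gForm_comm (v + w) w, gForm_add_right, gForm_add_right, gForm_comm (A v) v,
    gForm_comm (A w) w, gForm_comm (A w) v, gForm_comm w v] at h
  linarith

/-- A `g`-orthogonal basis of `n_{-2}` with three vectors of square `1` followed by five of
square `-1`. -/
def orthoBasis : Fin 8 → Pt :=
  ![Pi.single 0 1 + Pi.single 7 (1 / 2), Pi.single 1 1 - Pi.single 6 (1 / 2),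
    Pi.single 2 1 + Pi.single 5 (1 / 2), Pi.single 0 1 - Pi.single 7 (1 / 2),
    Pi.single 1 1 + Pi.single 6 (1 / 2), Pi.single 2 1 - Pi.single 5 (1 / 2),
    Pi.single 3 √2, Pi.single 4 √2]

theorem orthoBasis_mem (i : Fin 8) : orthoBasis i ∈ Nm2 := by
  intro k hk
  have ne (j : Fin 24) (hj : (j : ℕ) < 8) : k ≠ j := by
    rintro rfl
    omega
  fin_cases i <;> simp [orthoBasis, ne]

theorem gForm_orthoBasis (i j : Fin 8) :
    gForm (orthoBasis i) (orthoBasis j) =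
      if i = j then (if (i : ℕ) < 3 then 1 else -1) else 0 := by
  fin_cases i <;> simp [gForm, orthoBasis] <;> fin_cases j <;> norm_num <;> decide

theorem linearIndependent_orthoBasis : LinearIndependent ℝ orthoBasis := by
  rw [Fintype.linearIndependent_iff]
  intro c hc i
  have h (k : Fin 24) := congrFun hc k
  simp only [Fin.sum_univ_eight] at h
  have h0 := h 0
  have h1 := h 1
  have h2 := h 2
  have h3 := h 3
  have h4 := h 4
  have h5 := h 5
  have h6 := h 6
  have h7 := h 7
  simp [orthoBasis] at h0 h1 h2 h3 h4 h5 h6 h7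
  fin_cases i <;> simp <;> linarith

theorem span_orthoBasis : Submodule.span ℝ (Set.range orthoBasis) = Nm2 := by
  refine le_antisymm (Submodule.span_le.2 ?_) fun v hv => ?_
  · rintro _ ⟨i, rfl⟩
    exact orthoBasis_mem i
  · rw [Submodule.mem_span_range_iff_exists_fun]
    refine ⟨![v 0 / 2 + v 7, v 1 / 2 - v 6, v 2 / 2 + v 5, v 0 / 2 - v 7, v 1 / 2 + v 6,
      v 2 / 2 - v 5, v 3 / √2, v 4 / √2], ?_⟩
    ext k
    by_cases hk : (k : ℕ) < 8
    · fin_cases k <;> simp [Fin.sum_univ_eight, orthoBasis] at hk ⊢ <;> ring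
    · have hk := not_lt.mp hk
      rw [hv k hk, Finset.sum_apply]
      exact Finset.sum_eq_zero fun i _ => by simp [orthoBasis_mem i k hk]

/-- The form `g` on `n_{-2}` is symmetric, nondegenerate of signature `(3,5)`
(it admits an orthogonal basis of `n_{-2}` with 3 vectors of square `+1` and 5 of
square `-1`), and every strata-preserving derivation of `n_{E_II}` acts on `n_{-2}`
conformally with respect to `g`: the degree-zero part of the Tanaka prolongation acts on
`n_{-2}` as a subalgebra of `co(3,5)`. -/
theorem nEII_derivations_act_conformally_co_3_5 :
    (∀ v w : Pt, gForm v w = gForm w v) ∧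
    (∃ b : Fin 8 → Pt,
      (∀ i, b i ∈ Nm2) ∧ LinearIndependent ℝ b ∧
      Submodule.span ℝ (Set.range b) = Nm2 ∧
      ∀ i j, gForm (b i) (b j) =
        if i = j then (if (i : ℕ) < 3 then 1 else -1) else 0) ∧
    ∀ A : Module.End ℝ Pt, IsSPDer A →
      ∃ lam : ℝ, ∀ v ∈ Nm2, ∀ w ∈ Nm2,
        gForm (A v) w + gForm v (A w) = lam * gForm v w := by
  exact ⟨gForm_comm,
    ⟨orthoBasis, orthoBasis_mem, linearIndependent_orthoBasis, span_orthoBasis, gForm_orthoBasis⟩,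
    fun A hA => ⟨traceNm1 A / 4, fun _ hv _ hw => hA.gForm_map_add hv hw⟩⟩
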